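/- Any mechanism that places the facility between the leftmost and rightmost agents has maximum cost approximation ratio at most 2·r_q: let q : [0,1] → ℝ be a continuous scaling function with q(y) > 0 for all y, let n ≥ 1, let x_1 ≤ … ≤ x_n be agent locations in [0,1], and let y_0 ∈ [x_1, x_n]. Then for every y ∈ [0,1], q(y_0)·max_{1≤i≤n} |y_0 − x_i| ≤ 2·r_q·q(y)·max_{1≤i≤n} |y − x_i|. In particular, any phantom mechanism that places at least one phantom at 0 and at least one phantom at 1 (and hence always outputs a point of [x_1, x_n]) has maximum cost approximation ratio at most 2·r_q. -/

import Mathlib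

/-- A positive continuous function on a compact set varies by at most the factor
`sup / inf`. -/
theorem le_sSup_div_sInf_mul {X : Type*} [TopologicalSpace X] {s : Set X} {q : X → ℝ}
    (hs : IsCompact s) (hcont : ContinuousOn q s) (hpos : ∀ y ∈ s, 0 < q y) {a b : X}
    (ha : a ∈ s) (hb : b ∈ s) : q a ≤ sSup (q '' s) / sInf (q '' s) * q b := by
  have hK := hs.image_of_continuousOn hcont
  have hle_sup : q a ≤ sSup (q '' s) := le_csSup hK.bddAbove (Set.mem_image_of_mem q ha)
  have hinf_le : sInf (q '' s) ≤ q b := csInf_le hK.bddBelow (Set.mem_image_of_mem q hb)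
  have hinf_pos : 0 < sInf (q '' s) := by
    obtain ⟨c, hc, hqc⟩ := hK.sInf_mem ⟨q a, Set.mem_image_of_mem q ha⟩
    exact hqc ▸ hpos c hc
  rw [div_mul_eq_mul_div, le_div_iff₀ hinf_pos]
  exact mul_le_mul hle_sup hinf_le hinf_pos.le ((hpos a ha).le.trans hle_sup)

/-- A point between the extreme agents is at most twice as far from its farthest agent as any
other point is from its own farthest agent. -/
theorem sup'_abs_sub_le_two_mul_sup'_abs_sub {n : ℕ} (x : Fin (n + 1) → ℝ) (hmono : Monotone x)
    {y₀ : ℝ} (hy₀ : y₀ ∈ Set.Icc (x 0) (x (Fin.last n))) (y : ℝ) :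
    (Finset.univ.sup' Finset.univ_nonempty fun i => |y₀ - x i|)
      ≤ 2 * Finset.univ.sup' Finset.univ_nonempty fun i => |y - x i| := by
  have hleft := Finset.le_sup' (fun i => |y - x i|) (Finset.mem_univ 0)
  have hright := Finset.le_sup' (fun i => |y - x i|) (Finset.mem_univ (Fin.last n))
  refine Finset.sup'_le _ _ fun i _ => ?_
  have hi₀ := hmono (Fin.zero_le i)
  have hi₁ := hmono (Fin.le_last i)
  have hspread := le_abs_self (y - x 0)
  have hspread' := neg_abs_le (y - x (Fin.last n))
  rw [abs_le]
  constructor <;> linarith [hy₀.1, hy₀.2]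

/-- Any mechanism placing the facility between the leftmost and rightmost
agents has maximum cost approximation ratio at most `2·r_q`: for a continuous positive
scaling function `q`, agents `x₀ ≤ … ≤ xₙ` in `[0,1]` (at least one agent),
`r_q = (max_{[0,1]} q)/(min_{[0,1]} q)`, and any `y₀ ∈ [x₀, xₙ]`, the maximum cost at `y₀`
is at most `2·r_q` times the maximum cost at any `y ∈ [0,1]`. In particular this bounds any
phantom mechanism placing a phantom at `0` and a phantom at `1`. -/
theorem stmt_19 (q : ℝ → ℝ) (hcont : ContinuousOn q (Set.Icc 0 1))
    (hpos : ∀ y ∈ Set.Icc (0:ℝ) 1, 0 < q y)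
    (n : ℕ) (x : Fin (n+1) → ℝ) (hx : ∀ i, x i ∈ Set.Icc (0:ℝ) 1) (hmono : Monotone x)
    (rq : ℝ) (hrq : rq = sSup (q '' Set.Icc 0 1) / sInf (q '' Set.Icc 0 1))
    (y₀ : ℝ) (hy₀ : y₀ ∈ Set.Icc (x 0) (x (Fin.last n))) :
    ∀ y ∈ Set.Icc (0:ℝ) 1,
      q y₀ * (Finset.univ.sup' Finset.univ_nonempty fun i => |y₀ - x i|)
        ≤ 2 * rq * (q y * (Finset.univ.sup' Finset.univ_nonempty fun i => |y - x i|)) := by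
  intro y hy
  have hy₀I : y₀ ∈ Set.Icc (0 : ℝ) 1 :=
    ⟨(hx 0).1.trans hy₀.1, hy₀.2.trans (hx (Fin.last n)).2⟩
  have hq : q y₀ ≤ rq * q y := hrq ▸ le_sSup_div_sInf_mul isCompact_Icc hcont hpos hy₀I hy
  have hdist := sup'_abs_sub_le_two_mul_sup'_abs_sub x hmono hy₀ y
  have hM : 0 ≤ Finset.univ.sup' Finset.univ_nonempty fun i => |y₀ - x i| :=
    (abs_nonneg _).trans (Finset.le_sup' (fun i => |y₀ - x i|) (Finset.mem_univ 0))
  calc _ ≤ rq * q y * (2 * Finset.univ.sup' Finset.univ_nonempty fun i => |y - x i|) :=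
        mul_le_mul hq hdist hM ((hpos y₀ hy₀I).le.trans hq)
    _ = _ := by ring
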